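/- arXiv:1407.1615 — 7 statements merged into one kernel-verified Lean document; each statement's English description precedes it below -/
import Mathlib

section
/- Let e : ℕ → ℝ be nonincreasing with e(n) ≥ 0 for all n and lim_{n→∞} e(n) = 0, and for ε > 0 let n(ε) := min{n ∈ ℕ : e(n) ≤ ε}. Assume that for every δ > 0 there exists M > 0 such that for all ε ∈ (0,1) with log(1/ε) > M one has log n(ε) < δ · log(1/ε) (with the convention log 0 = 0). Then for every α > 0 one has lim_{n→∞} n^α · e(n) = 0. -/
/-- If the logarithm of the information complexity is `o(log (1/ε))`, then the nonincreasing null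
sequence `e` is eventually bounded by every negative power of `n`. -/
theorem eventually_le_rpow_neg_of_log_complexity_lt (e : ℕ → ℝ)
    (hmono : ∀ m n : ℕ, m ≤ n → e n ≤ e m)
    (hlim : Filter.Tendsto e Filter.atTop (nhds 0))
    (hECWT : ∀ δ > (0:ℝ), ∃ M > (0:ℝ), ∀ ε : ℝ, ε ∈ Set.Ioo (0:ℝ) 1 →
      M < Real.log (1/ε) →
      Real.log ((sInf {n : ℕ | e n ≤ ε} : ℕ) : ℝ) < δ * Real.log (1/ε))
    {β : ℝ} (hβ : 0 < β) :
    ∀ᶠ n : ℕ in Filter.atTop, e n ≤ (n:ℝ) ^ (-β) := by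
  obtain ⟨M, -, hM⟩ := hECWT β⁻¹ (inv_pos.2 hβ)
  have hlog : Filter.Tendsto (fun n : ℕ => β * Real.log n) Filter.atTop Filter.atTop :=
    (Real.tendsto_log_atTop.comp tendsto_natCast_atTop_atTop).const_mul_atTop hβ
  filter_upwards [hlog.eventually_gt_atTop M, Filter.eventually_gt_atTop 1] with n hnM hn
  have hn1 : (1:ℝ) < n := by exact_mod_cast hn
  have hn0 : (0:ℝ) < n := by linarith
  have hεpos : 0 < (n:ℝ) ^ (-β) := Real.rpow_pos_of_pos hn0 _
  have hlogε : Real.log (1 / (n:ℝ) ^ (-β)) = β * Real.log n := by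
    rw [one_div, Real.log_inv, Real.log_rpow hn0]
    ring
  have hlt := hM _ ⟨hεpos, Real.rpow_lt_one_of_one_lt_of_neg hn1 (neg_neg_of_pos hβ)⟩
    (hlogε ▸ hnM)
  rw [hlogε, inv_mul_cancel_left₀ hβ.ne'] at hlt
  have hmem : e (sInf {k : ℕ | e k ≤ (n:ℝ) ^ (-β)}) ≤ (n:ℝ) ^ (-β) :=
    Nat.sInf_mem (s := {k : ℕ | e k ≤ (n:ℝ) ^ (-β)}) (hlim.eventually_le_const hεpos).exists
  refine (hmono _ _ ?_).trans hmem
  by_contra! hgt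
  exact hlt.not_ge (Real.log_le_log hn0 (by exact_mod_cast hgt.le))

theorem stmt_4 (e : ℕ → ℝ)
    (hmono : ∀ m n : ℕ, m ≤ n → e n ≤ e m)
    (hnonneg : ∀ n, 0 ≤ e n)
    (hlim : Filter.Tendsto e Filter.atTop (nhds 0))
    (hECWT : ∀ δ > (0:ℝ), ∃ M > (0:ℝ), ∀ ε : ℝ, ε ∈ Set.Ioo (0:ℝ) 1 →
      M < Real.log (1/ε) →
      Real.log ((sInf {n : ℕ | e n ≤ ε} : ℕ) : ℝ) < δ * Real.log (1/ε)) :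
    ∀ α > (0:ℝ),
      Filter.Tendsto (fun n : ℕ => (n:ℝ) ^ α * e n) Filter.atTop (nhds 0) := by
  intro α hα
  have hbound := eventually_le_rpow_neg_of_log_complexity_lt e hmono hlim hECWT
    (β := α + α) (by positivity)
  refine squeeze_zero' (.of_forall fun n => mul_nonneg (by positivity) (hnonneg n)) ?_
    ((tendsto_rpow_neg_atTop hα).comp tendsto_natCast_atTop_atTop)
  filter_upwards [hbound, Filter.eventually_gt_atTop 0] with n hn hn0
  have hn0' : (0:ℝ) < n := by exact_mod_cast hn0
  calc (n:ℝ) ^ α * e n ≤ (n:ℝ) ^ α * (n:ℝ) ^ (-(α + α)) := by gcongr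
    _ = (n:ℝ) ^ (-α) := by
      rw [← Real.rpow_add hn0']
      congr 1
      ring
end

section
/- Let q ∈ (0,1), C ≥ 1, C_1 > 0 and p > 0, and let e : ℕ → ℝ be nonincreasing with 0 ≤ e(n) ≤ 1 for all n and lim_{n→∞} e(n) = 0; for ε > 0 let n(ε) := min{n ∈ ℕ : e(n) ≤ ε}. Assume that for every ε ∈ (0,1) one has n(ε) ≤ ⌈C_1 · ((log C + log(1/ε)) / log(1/q))^{1/p}⌉. Then for every n ∈ ℕ one has e(n+1) ≤ C · q^{(n/C_1)^p}. -/
theorem stmt_6 (q C C₁ p : ℝ) (hq : q ∈ Set.Ioo (0:ℝ) 1) (hC : 1 ≤ C)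
    (hC₁ : 0 < C₁) (hp : 0 < p) (e : ℕ → ℝ)
    (hmono : ∀ m n : ℕ, m ≤ n → e n ≤ e m)
    (hrange : ∀ n, e n ∈ Set.Icc (0:ℝ) 1)
    (hlim : Filter.Tendsto e Filter.atTop (nhds 0))
    (hn : ∀ ε ∈ Set.Ioo (0:ℝ) 1,
      sInf {n : ℕ | e n ≤ ε} ≤
        ⌈C₁ * ((Real.log C + Real.log (1/ε)) / Real.log (1/q)) ^ (1/p)⌉₊) :
    ∀ n : ℕ, e (n + 1) ≤ C * q ^ (((n : ℝ) / C₁) ^ p) := by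
  intro n
  obtain ⟨hq0, hq1⟩ := hq
  have hC0 : 0 < C := by linarith
  have hqpow : 0 < q ^ (((n : ℝ) / C₁) ^ p) := Real.rpow_pos_of_pos hq0 _
  set ε := C * q ^ (((n : ℝ) / C₁) ^ p) with hε
  have hε0 : 0 < ε := mul_pos hC0 hqpow
  rcases le_or_gt 1 ε with h1 | h1
  · exact (hrange _).2.trans h1
  have hlogq : Real.log q < 0 := Real.log_neg hq0 hq1
  have hquot : (Real.log C + Real.log (1/ε)) / Real.log (1/q) = ((n : ℝ) / C₁) ^ p := by
    rw [one_div, one_div, Real.log_inv, Real.log_inv, hε,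
      Real.log_mul hC0.ne' hqpow.ne', Real.log_rpow hq0]
    field_simp [hlogq.ne]
    ring
  have hle := hn ε ⟨hε0, h1⟩
  rw [hquot, one_div, Real.rpow_rpow_inv (by positivity) hp.ne',
    mul_div_cancel₀ _ hC₁.ne', Nat.ceil_natCast] at hle
  have hne : {m : ℕ | e m ≤ ε}.Nonempty := (hlim.eventually_le_const hε0).exists
  exact (hmono _ _ (hle.trans n.le_succ)).trans (Nat.sInf_mem hne)
end

section
/- Let e : ℕ × ℕ → ℝ be such that for every s ≥ 1 the function n ↦ e(n,s) is nonincreasing, takes values in [0,1], and tends to 0 as n → ∞; for ε > 0 and s ≥ 1 let n(ε,s) := min{n ∈ ℕ : e(n,s) ≤ ε}. Assume there exist constants c > 0 and τ_1 ≥ 0, τ_2 > 0 such that n(ε,s) ≤ c · s^{τ_1} · (1 + log(1/ε))^{τ_2} for all ε ∈ (0,1) and all s ≥ 1. Then for all n ∈ ℕ and all s ≥ 1 one has e(n,s) ≤ exp(1) · exp(−(n/(c·s^{τ_1}))^{1/τ_2}); that is, uniform exponential convergence holds with C(s) = e, q = 1/e, C_1(s) = c·s^{τ_1} and p = 1/τ_2.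 -/
theorem stmt_7 (e : ℕ → ℕ → ℝ)
    (hmono : ∀ s : ℕ, 1 ≤ s → ∀ m n : ℕ, m ≤ n → e n s ≤ e m s)
    (hrange : ∀ s : ℕ, 1 ≤ s → ∀ n : ℕ, e n s ∈ Set.Icc (0:ℝ) 1)
    (hlim : ∀ s : ℕ, 1 ≤ s →
      Filter.Tendsto (fun n => e n s) Filter.atTop (nhds 0))
    (c τ₁ τ₂ : ℝ) (hc : 0 < c) (hτ₁ : 0 ≤ τ₁) (hτ₂ : 0 < τ₂)
    (hECPT : ∀ ε ∈ Set.Ioo (0:ℝ) 1, ∀ s : ℕ, 1 ≤ s →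
      ((sInf {n : ℕ | e n s ≤ ε} : ℕ) : ℝ) ≤
        c * (s:ℝ) ^ τ₁ * (1 + Real.log (1/ε)) ^ τ₂) :
    ∀ n : ℕ, ∀ s : ℕ, 1 ≤ s →
      e n s ≤ Real.exp 1 *
        Real.exp (-(((n:ℝ) / (c * (s:ℝ) ^ τ₁)) ^ (1/τ₂))) := by
  intro n s hs
  refine le_of_forall_lt_imp_le_of_dense fun ε hε => ?_
  rcases le_or_gt ε 0 with h0 | h0
  · exact h0.trans (by positivity)
  have hε1 : ε < 1 := hε.trans_le (hrange s hs n).2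
  have hne : {m : ℕ | e m s ≤ ε}.Nonempty :=
    (((hlim s hs).eventually (gt_mem_nhds h0)).exists).imp fun _ h => h.le
  have hn : n ≤ sInf {m : ℕ | e m s ≤ ε} := by
    by_contra! h
    exact absurd ((hmono s hs _ _ h.le).trans (Nat.sInf_mem hne)) hε.not_ge
  have hs0 : (0:ℝ) < s := by exact_mod_cast hs
  have hA : 0 < c * (s:ℝ) ^ τ₁ := mul_pos hc (Real.rpow_pos_of_pos hs0 _)
  have hbound : (n:ℝ) / (c * (s:ℝ) ^ τ₁) ≤ (1 + Real.log (1/ε)) ^ τ₂ :=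
    (div_le_iff₀' hA).2 ((Nat.cast_le.2 hn).trans (hECPT ε ⟨h0, hε1⟩ s hs))
  have hlog : Real.log (1/ε) = -Real.log ε := by rw [one_div, Real.log_inv]
  have hneg : Real.log ε < 0 := Real.log_neg h0 hε1
  rw [hlog] at hbound
  have hroot : ((n:ℝ) / (c * (s:ℝ) ^ τ₁)) ^ (1/τ₂) ≤ 1 + -Real.log ε := by
    rw [one_div]
    exact (Real.rpow_inv_le_iff_of_pos (by positivity) (by linarith) hτ₂).2 hbound
  rw [← Real.exp_add, ← Real.log_le_iff_le_exp h0]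
  linarith
end

section
/- Let e : ℕ × ℕ → ℝ be such that for every s ≥ 1 the function n ↦ e(n,s) is nonincreasing, nonnegative, and tends to 0 as n → ∞; for ε > 0 and s ≥ 1 let n(ε,s) := min{n ∈ ℕ : e(n,s) ≤ ε}. Assume there exist q ∈ (0,1), p > 0 and functions C, C_1 : ℕ → (0,∞) with C(s) ≥ 1 for all s such that e(n,s) ≤ C(s) · q^{(n/C_1(s))^p} for all n, s ≥ 1, and such that lim_{s→∞} log(max(1, log C(s)))/s = 0 and lim_{s→∞} log(C_1(s))/s = 0. Then EC-WT holds: for every δ > 0 there exists M > 0 such that for all s ≥ 1 and ε ∈ (0,1) with s + log(1/ε) ≥ M one has log(1 + n(ε,s)) ≤ δ · (s + log(1/ε)). -/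
/-- A real sequence `f` with `f s / s → 0` is bounded above by `K + η * s` for every `η > 0`. -/
theorem exists_forall_le_add_mul_of_tendsto_div {f : ℕ → ℝ}
    (hf : Filter.Tendsto (fun s : ℕ => f s / (s : ℝ)) Filter.atTop (nhds 0))
    {η : ℝ} (hη : 0 < η) : ∃ K : ℝ, 0 ≤ K ∧ ∀ s : ℕ, f s ≤ K + η * s := by
  obtain ⟨N, hN⟩ := Filter.eventually_atTop.1
    ((hf.eventually_lt_const hη).and (Filter.eventually_ge_atTop 1))
  refine ⟨∑ i ∈ Finset.range N, |f i|, Finset.sum_nonneg fun i _ => abs_nonneg _, fun s => ?_⟩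
  have hs0 : (0 : ℝ) ≤ η * s := by positivity
  rcases lt_or_ge s N with h | h
  · have h1 : |f s| ≤ ∑ i ∈ Finset.range N, |f i| :=
      Finset.single_le_sum (f := fun i => |f i|) (fun i _ => abs_nonneg _)
        (Finset.mem_range.2 h)
    linarith [le_abs_self (f s)]
  · obtain ⟨h1, h2⟩ := hN s h
    have hs : (0 : ℝ) < s := by exact_mod_cast h2
    have h3 : 0 ≤ ∑ i ∈ Finset.range N, |f i| := Finset.sum_nonneg fun i _ => abs_nonneg _
    linarith [(div_lt_iff₀ hs).1 h1]

/-- The logarithm grows at most linearly, with arbitrarily small slope. -/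
theorem log_one_add_le_abs_log_add_mul {η L : ℝ} (hη : 0 < η) (hL : 0 ≤ L) :
    Real.log (1 + L) ≤ (η + |Real.log η|) + η * L := by
  have h := Real.log_le_sub_one_of_pos (x := η * (1 + L)) (by positivity)
  rw [Real.log_mul hη.ne' (by positivity)] at h
  linarith [neg_abs_le (Real.log η)]

/-- If `n` is at least `c * (A / log (1 / q)) ^ (1 / p)`, where `A` bounds `log (C / ε)`, then
`C * q ^ ((n / c) ^ p)` is at most `ε`. -/
theorem mul_rpow_div_rpow_le {q p C c ε A x : ℝ} (hq : q ∈ Set.Ioo (0 : ℝ) 1) (hp : 0 < p)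
    (hC : 0 < C) (hc : 0 < c) (hε : 0 < ε) (hA : 0 ≤ A)
    (hCA : Real.log C + Real.log (1 / ε) ≤ A)
    (hx : c * (A / Real.log (1 / q)) ^ (1 / p) ≤ x) :
    C * q ^ ((x / c) ^ p) ≤ ε := by
  have ha : 0 < Real.log (1 / q) := Real.log_pos ((one_lt_div hq.1).2 hq.2)
  have h1 : (A / Real.log (1 / q)) ^ (1 / p) ≤ x / c := by
    rw [le_div_iff₀ hc]; linarith
  have h2 : A / Real.log (1 / q) ≤ (x / c) ^ p := by
    have h := Real.rpow_le_rpow (by positivity) h1 hp.le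
    rwa [← Real.rpow_mul (by positivity), one_div_mul_cancel hp.ne', Real.rpow_one] at h
  have h3 : A ≤ (x / c) ^ p * Real.log (1 / q) := (div_le_iff₀ ha).1 h2
  have hqp : 0 < q ^ ((x / c) ^ p) := Real.rpow_pos_of_pos hq.1 _
  rw [← Real.log_le_log_iff (by positivity) hε, Real.log_mul hC.ne' hqp.ne',
    Real.log_rpow hq.1]
  rw [one_div, Real.log_inv] at h3 hCA
  linarith

/-- Logarithmic form of an upper bound on a minimal natural number. -/
theorem log_one_add_natCast_le {n : ℕ} {X B : ℝ} (hX : 0 < X)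
    (hn : (n : ℝ) ≤ X + 1) (hB : 0 ≤ B) (hXB : Real.log X ≤ B) :
    Real.log (1 + (n : ℝ)) ≤ Real.log 3 + B := by
  have h1 : X ≤ Real.exp B := (Real.log_le_iff_le_exp hX).1 hXB
  have h2 : 1 ≤ Real.exp B := Real.one_le_exp hB
  calc Real.log (1 + (n : ℝ)) ≤ Real.log (3 * Real.exp B) :=
        Real.log_le_log (by positivity) (by linarith)
    _ = Real.log 3 + B := by rw [Real.log_mul (by norm_num) (Real.exp_ne_zero _), Real.log_exp]


theorem stmt_8 (e : ℕ → ℕ → ℝ)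
    (hmono : ∀ s : ℕ, 1 ≤ s → ∀ m n : ℕ, m ≤ n → e n s ≤ e m s)
    (hnonneg : ∀ n s : ℕ, 0 ≤ e n s)
    (hlim : ∀ s : ℕ, 1 ≤ s →
      Filter.Tendsto (fun n => e n s) Filter.atTop (nhds 0))
    (q p : ℝ) (hq : q ∈ Set.Ioo (0:ℝ) 1) (hp : 0 < p)
    (C C₁ : ℕ → ℝ) (hC : ∀ s, 1 ≤ C s) (hC₁ : ∀ s, 0 < C₁ s)
    (hbound : ∀ n s : ℕ, 1 ≤ n → 1 ≤ s →
      e n s ≤ C s * q ^ (((n:ℝ) / C₁ s) ^ p))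
    (hCgrowth : Filter.Tendsto
      (fun s : ℕ => Real.log (max 1 (Real.log (C s))) / (s:ℝ))
      Filter.atTop (nhds 0))
    (hC₁growth : Filter.Tendsto (fun s : ℕ => Real.log (C₁ s) / (s:ℝ))
      Filter.atTop (nhds 0)) :
    ∀ δ > (0:ℝ), ∃ M > (0:ℝ), ∀ s : ℕ, 1 ≤ s → ∀ ε ∈ Set.Ioo (0:ℝ) 1,
      M ≤ (s:ℝ) + Real.log (1/ε) →
      Real.log (1 + ((sInf {n : ℕ | e n s ≤ ε} : ℕ) : ℝ)) ≤
        δ * ((s:ℝ) + Real.log (1/ε)) := by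
  intro δ hδ
  set a := Real.log (1 / q) with ha_def
  have ha : 0 < a := Real.log_pos ((one_lt_div hq.1).2 hq.2)
  obtain ⟨η, hη, hηδ⟩ : ∃ η : ℝ, 0 < η ∧ η + 1 / p * η = δ / 2 :=
    ⟨δ / 2 / (1 + 1 / p), by positivity, by field_simp⟩
  obtain ⟨K₁, hK₁, hf₁⟩ := exists_forall_le_add_mul_of_tendsto_div hC₁growth hη
  obtain ⟨K₂, hK₂, hf₂⟩ := exists_forall_le_add_mul_of_tendsto_div hCgrowth hη
  set B := Real.log 3 + (K₁ + 1 / p * (η + |Real.log η| + K₂ + |Real.log a|)) with hB_def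
  refine ⟨max 1 (2 * B / δ), by positivity, fun s hs ε hε hM => ?_⟩
  have hL : 0 < Real.log (1 / ε) := Real.log_pos ((one_lt_div hε.1).2 hε.2)
  set L := Real.log (1 / ε) with hL_def
  set D := max 1 (Real.log (C s)) with hD_def
  have hD : 1 ≤ D := le_max_left _ _
  have hCD : Real.log (C s) ≤ D := le_max_right _ _
  have hD0 : 0 < D := by linarith
  set X := C₁ s * ((1 + L) * D / a) ^ (1 / p) with hX_def
  have hX : 0 < X := mul_pos (hC₁ s) (by positivity)
  have hmem : e (⌊X⌋₊ + 1) s ≤ ε :=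
    (hbound _ s (by omega) hs).trans <|
      mul_rpow_div_rpow_le (A := (1 + L) * D) hq hp (by linarith [hC s]) (hC₁ s) hε.1
        (by positivity) (by nlinarith) (by push_cast; exact (Nat.lt_floor_add_one X).le)
  have hn : ((sInf {n : ℕ | e n s ≤ ε} : ℕ) : ℝ) ≤ X + 1 := by
    have h1 : sInf {n : ℕ | e n s ≤ ε} ≤ ⌊X⌋₊ + 1 := Nat.sInf_le hmem
    have h2 : ((sInf {n : ℕ | e n s ≤ ε} : ℕ) : ℝ) ≤ (⌊X⌋₊ : ℝ) + 1 := by exact_mod_cast h1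
    linarith [Nat.floor_le hX.le]
  have hlogX : Real.log X =
      Real.log (C₁ s) + 1 / p * (Real.log (1 + L) + Real.log D - Real.log a) := by
    rw [hX_def, Real.log_mul (hC₁ s).ne' (by positivity), Real.log_rpow (by positivity),
      Real.log_div (by positivity) ha.ne', Real.log_mul (by positivity) hD0.ne']
  have hXB : Real.log X ≤ K₁ + η * s +
      1 / p * (η + |Real.log η| + η * L + (K₂ + η * s) + |Real.log a|) := by
    rw [hlogX]
    gcongr
    · exact hf₁ s
    · linarith [log_one_add_le_abs_log_add_mul hη hL.le, hf₂ s, neg_abs_le (Real.log a)]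
  have hmain := log_one_add_natCast_le hX hn (by positivity) hXB
  have hBM : B ≤ δ / 2 * (s + L) := by
    have h := (div_le_iff₀ hδ).1 ((le_max_right _ _).trans hM)
    linarith
  have hsL : η * L + 1 / p * (η * L) = δ / 2 * L := by rw [← hηδ]; ring
  have hss : η * s + 1 / p * (η * s) = δ / 2 * s := by rw [← hηδ]; ring
  have hηL : 0 < η * L := by positivity
  linarith
end

section
/- Let e : ℕ × ℕ → ℝ be such that for every s ≥ 1 the function n ↦ e(n,s) is nonincreasing, nonnegative, and tends to 0 as n → ∞; for ε > 0 and s ≥ 1 let n(ε,s) := min{n ∈ ℕ : e(n,s) ≤ ε}. Assume there exist q ∈ (0,1), p > 0, A > 0, A_1 > 0, η ≥ 0, η_1 ≥ 0 and functions p(·) ≥ p, C(·), C_1(·) with C(s) ≥ 1 such that e(n,s) ≤ C(s) · q^{(n/C_1(s))^{p(s)}} for all n, s ≥ 1, and C(s) ≤ exp(A·s^η) and C_1(s) ≤ A_1·s^{η_1} for all s ≥ 1. Then EC-PT holds with exponents τ_1 = η_1 + η/p and τ_2 = 1/p: there exists c ≥ 0 such that n(ε,s) ≤ c · s^{η_1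 + η/p} · (1 + log(1/ε))^{1/p} for all ε ∈ (0,1) and all s ≥ 1. -/
theorem stmt_9 (e : ℕ → ℕ → ℝ)
    (hmono : ∀ s : ℕ, 1 ≤ s → ∀ m n : ℕ, m ≤ n → e n s ≤ e m s)
    (hnonneg : ∀ n s : ℕ, 0 ≤ e n s)
    (hlim : ∀ s : ℕ, 1 ≤ s →
      Filter.Tendsto (fun n => e n s) Filter.atTop (nhds 0))
    (q p A A₁ η η₁ : ℝ) (hq : q ∈ Set.Ioo (0:ℝ) 1) (hp : 0 < p)
    (hA : 0 < A) (hA₁ : 0 < A₁) (hη : 0 ≤ η) (hη₁ : 0 ≤ η₁)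
    (pfun C C₁ : ℕ → ℝ)
    (hpfun : ∀ s, p ≤ pfun s) (hCone : ∀ s, 1 ≤ C s) (hC₁pos : ∀ s, 0 < C₁ s)
    (hbound : ∀ n s : ℕ, 1 ≤ n → 1 ≤ s →
      e n s ≤ C s * q ^ (((n:ℝ) / C₁ s) ^ (pfun s)))
    (hCbd : ∀ s : ℕ, 1 ≤ s → C s ≤ Real.exp (A * (s:ℝ) ^ η))
    (hC₁bd : ∀ s : ℕ, 1 ≤ s → C₁ s ≤ A₁ * (s:ℝ) ^ η₁) :
    ∃ c ≥ (0:ℝ), ∀ ε ∈ Set.Ioo (0:ℝ) 1, ∀ s : ℕ, 1 ≤ s →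
      ((sInf {n : ℕ | e n s ≤ ε} : ℕ) : ℝ) ≤
        c * (s:ℝ) ^ (η₁ + η / p) * (1 + Real.log (1/ε)) ^ (1/p) := by
  obtain ⟨hq0, hq1⟩ := hq
  have hlam : 0 < -Real.log q := by linarith [Real.log_neg hq0 hq1]
  set lam := -Real.log q with hlam_def
  set K : ℝ := 1 + (A + 1) / lam with hK
  have hK1 : 1 ≤ K := by
    have : 0 ≤ (A + 1) / lam := by positivity
    linarith
  have hKlam : A + 1 ≤ lam * K := by
    have : lam * K = lam + (A + 1) := by rw [hK]; field_simp
    linarith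
  refine ⟨A₁ * K ^ (1 / p) + 1, by positivity, ?_⟩
  rintro ε ⟨hε0, hε1⟩ s hs
  have hs1 : (1 : ℝ) ≤ s := by exact_mod_cast hs
  have hs0 : (0 : ℝ) < s := by linarith
  have hlogε : Real.log (1 / ε) = -Real.log ε := by rw [one_div, Real.log_inv]
  have hL : 1 ≤ 1 + Real.log (1 / ε) := by linarith [Real.log_neg hε0 hε1]
  set L := 1 + Real.log (1 / ε) with hL_def
  have hS : 1 ≤ (s : ℝ) ^ η := Real.one_le_rpow hs1 hη
  set S := (s : ℝ) ^ η with hS_def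
  have hSL : L ≤ S * L := le_mul_of_one_le_left (by linarith) hS
  have hSL' : S ≤ S * L := le_mul_of_one_le_right (by linarith) hL
  have hX : 1 ≤ K * (S * L) := one_le_mul_of_one_le_of_one_le hK1 (hL.trans hSL)
  set X := K * (S * L) with hX_def
  have hY : 1 ≤ X ^ (1 / p) := Real.one_le_rpow hX (by positivity)
  set Y := X ^ (1 / p) with hY_def
  have hC := hC₁pos s
  have hCY : 0 < C₁ s * Y := by positivity
  set n := ⌈C₁ s * Y⌉₊ with hn_def
  have hn1 : 1 ≤ n := Nat.ceil_pos.2 hCY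
  have hYn : Y ≤ n / C₁ s := by
    rw [le_div_iff₀ hC, mul_comm]
    exact Nat.le_ceil _
  have hXn : X ≤ ((n : ℝ) / C₁ s) ^ pfun s := calc
    X = Y ^ p := by
      rw [hY_def, ← Real.rpow_mul (by linarith), one_div_mul_cancel hp.ne', Real.rpow_one]
    _ ≤ Y ^ pfun s := Real.rpow_le_rpow_of_exponent_le hY (hpfun s)
    _ ≤ _ := Real.rpow_le_rpow (by linarith) hYn (hp.le.trans (hpfun s))
  have hexponent : A * S + -lam * X ≤ Real.log ε := by
    have h1 : (A + 1) * (S * L) ≤ lam * K * (S * L) :=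
      mul_le_mul_of_nonneg_right hKlam (by linarith)
    have h2 : A * S ≤ A * (S * L) := mul_le_mul_of_nonneg_left hSL' hA.le
    have h3 : -lam * X = -(lam * K * (S * L)) := by rw [hX_def]; ring
    linarith
  have hmem : e n s ≤ ε := calc
    e n s ≤ C s * q ^ (((n : ℝ) / C₁ s) ^ pfun s) := hbound n s hn1 hs
    _ ≤ Real.exp (A * S) * q ^ X :=
      mul_le_mul (hCbd s hs) (Real.rpow_le_rpow_of_exponent_ge hq0 hq1.le hXn)
        (by positivity) (by positivity)
    _ = Real.exp (A * S + -lam * X) := by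
      rw [Real.rpow_def_of_pos hq0, ← Real.exp_add, hlam_def, neg_neg]
    _ ≤ ε := (Real.le_log_iff_exp_le hε0).1 hexponent
  have hY_eq : Y = K ^ (1 / p) * ((s : ℝ) ^ (η / p) * L ^ (1 / p)) := by
    rw [hY_def, hX_def, Real.mul_rpow (by linarith) (by linarith),
      Real.mul_rpow (by linarith) (by linarith), hS_def, ← Real.rpow_mul hs0.le, mul_one_div]
  have hone : 1 ≤ (s : ℝ) ^ (η₁ + η / p) * L ^ (1 / p) :=
    one_le_mul_of_one_le_of_one_le (Real.one_le_rpow hs1 (by positivity))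
      (Real.one_le_rpow hL (by positivity))
  calc ((sInf {n : ℕ | e n s ≤ ε} : ℕ) : ℝ) ≤ n := by exact_mod_cast Nat.sInf_le hmem
    _ ≤ C₁ s * Y + 1 := (Nat.ceil_lt_add_one hCY.le).le
    _ ≤ A₁ * (s : ℝ) ^ η₁ * Y + (s : ℝ) ^ (η₁ + η / p) * L ^ (1 / p) :=
      add_le_add (mul_le_mul_of_nonneg_right (hC₁bd s hs) (by linarith)) hone
    _ = (A₁ * K ^ (1 / p) + 1) * (s : ℝ) ^ (η₁ + η / p) * L ^ (1 / p) := by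
      rw [hY_eq, Real.rpow_add hs0]
      ring
end

section
/- Let s ≥ 1, ω ∈ (0,1), and let 0 < a_1 ≤ a_2 ≤ ⋯ ≤ a_s be real numbers; set a_0 := 0. For any points x_1,…,x_s ∈ [0,1]^s there exist complex numbers α_0, α_1, …, α_s with ∑_{j=0}^s |α_j|² = 1 such that: (i) the function f(x) := α_0 + ∑_{j=1}^s α_j·exp(2πi·x_j) (x = (x_1,…,x_s) ∈ [0,1]^s) satisfies f(x_k) = 0 for every k = 1,…,s; (ii) ∫_{[0,1]^s} |f(x)|² dx = 1; and (iii) ∑_{j=0}^s ∑_{k=0, k≠j}^s |α_j|²·|α_k|²·ω^{−(a_j + a_k)} ≤ ω^{−2·a_s}. -/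
open MeasureTheory

/-- The Fourier character with integer frequency vector `n` on `ℝ^d`. -/
noncomputable def fourierChar {d : Type*} [Fintype d] (n : d → ℤ) (z : d → ℝ) : ℂ :=
  Complex.exp (2 * Real.pi * Complex.I * ∑ i, (n i : ℂ) * (z i : ℂ))

lemma continuous_fourierChar {d : Type*} [Fintype d] (n : d → ℤ) :
    Continuous (fourierChar n) := by
  unfold fourierChar
  fun_prop

lemma fourierChar_mul_conj {d : Type*} [Fintype d] (m n : d → ℤ) (z : d → ℝ) :
    fourierChar m z * (starRingEnd ℂ) (fourierChar n z) = fourierChar (m - n) z := by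
  unfold fourierChar
  rw [← Complex.exp_conj, ← Complex.exp_add]
  congr 1
  simp only [map_mul, map_sum, map_ofNat, Complex.conj_ofReal, Complex.conj_I, map_intCast,
    Pi.sub_apply, Int.cast_sub, sub_mul, Finset.sum_sub_distrib]
  ring

lemma integral_Icc_exp_int (n : ℤ) :
    ∫ t in Set.Icc (0 : ℝ) 1, Complex.exp (2 * Real.pi * Complex.I * n * t) =
      if n = 0 then 1 else 0 := by
  rw [integral_Icc_eq_integral_Ioc, ← intervalIntegral.integral_of_le zero_le_one]
  split_ifs with hn
  · simp [hn]
  · have hc : (2 * Real.pi * Complex.I * n : ℂ) ≠ 0 :=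
      mul_ne_zero Complex.two_pi_I_ne_zero (Int.cast_ne_zero.mpr hn)
    have h1 : Complex.exp (2 * Real.pi * Complex.I * n) = 1 := by
      rw [mul_comm]
      exact Complex.exp_int_mul_two_pi_mul_I n
    rw [integral_exp_mul_complex hc]
    simp [h1]

lemma integral_fourierChar {d : Type*} [Fintype d] (n : d → ℤ) :
    ∫ z in Set.Icc (0 : d → ℝ) 1, fourierChar n z = if n = 0 then 1 else 0 := by
  classical
  have hprod : ∀ z, fourierChar n z =
      ∏ i, Complex.exp (2 * Real.pi * Complex.I * n i * (z i : ℂ)) := fun z => by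
    rw [fourierChar, Finset.mul_sum, Complex.exp_sum]
    simp only [mul_assoc]
  simp only [hprod]
  rw [← Set.pi_univ_Icc, volume_pi, Measure.restrict_pi_pi,
    integral_fintype_prod_eq_prod
      (fun i (t : ℝ) => Complex.exp (2 * Real.pi * Complex.I * n i * (t : ℂ)))]
  simp only [Pi.zero_apply, Pi.one_apply, integral_Icc_exp_int]
  split_ifs with h
  · simp [h]
  · obtain ⟨i, hi⟩ := Function.ne_iff.mp h
    exact Finset.prod_eq_zero (Finset.mem_univ i) (if_neg hi)

/-- Parseval's identity for trigonometric polynomials on the unit cube. -/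
lemma integral_normSq_sum_fourierChar {ι d : Type*} [Fintype ι] [Fintype d]
    (n : ι → d → ℤ) (hn : Function.Injective n) (α : ι → ℂ) :
    ∫ z in Set.Icc (0 : d → ℝ) 1, ‖∑ j, α j * fourierChar (n j) z‖ ^ 2 =
      ∑ j, ‖α j‖ ^ 2 := by
  classical
  have hint : ∀ j k, IntegrableOn
      (fun z => α j * (starRingEnd ℂ) (α k) * fourierChar (n j - n k) z)
      (Set.Icc (0 : d → ℝ) 1) := fun j k =>
    (continuous_const.mul (continuous_fourierChar _)).continuousOn.integrableOn_compact
      isCompact_Icc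
  have hexp : ∀ z, ((‖∑ j, α j * fourierChar (n j) z‖ ^ 2 : ℝ) : ℂ) =
      ∑ j, ∑ k, α j * (starRingEnd ℂ) (α k) * fourierChar (n j - n k) z := fun z => by
    push_cast
    rw [← Complex.mul_conj', map_sum, Finset.sum_mul_sum]
    refine Finset.sum_congr rfl fun j _ => Finset.sum_congr rfl fun k _ => ?_
    rw [← fourierChar_mul_conj, map_mul]
    ring
  rw [← Complex.ofReal_inj, ← integral_complex_ofReal]
  simp only [hexp]
  rw [integral_finsetSum _ fun j _ => integrable_finsetSum _ fun k _ => hint j k]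
  push_cast
  refine Finset.sum_congr rfl fun j _ => ?_
  rw [integral_finsetSum _ fun k _ => hint j k]
  simp only [integral_const_mul, integral_fourierChar, sub_eq_zero, hn.eq_iff, mul_ite, mul_one,
    mul_zero, Finset.sum_ite_eq, Finset.mem_univ, if_true]
  exact Complex.mul_conj' _

/-- A homogeneous linear system with more unknowns than equations has a solution of unit norm. -/
lemma exists_sum_norm_sq_eq_one_of_card_lt {ι κ : Type*} [Fintype ι] [Fintype κ]
    (hcard : Fintype.card κ < Fintype.card ι) (M : Matrix κ ι ℂ) :
    ∃ α : ι → ℂ, ∑ j, ‖α j‖ ^ 2 = 1 ∧ M.mulVec α = 0 := by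
  obtain ⟨v, hv, hv0⟩ := (Submodule.ne_bot_iff _).mp
    (LinearMap.ker_ne_bot_of_finrank_lt (f := M.mulVecLin) (by simpa using hcard))
  have hMv : M.mulVec v = 0 := hv
  obtain ⟨i, hi⟩ := Function.ne_iff.mp hv0
  have hpos : 0 < ∑ j, ‖v j‖ ^ 2 :=
    Finset.sum_pos' (fun _ _ => by positivity)
      ⟨i, Finset.mem_univ i, pow_pos (norm_pos_iff.mpr hi) 2⟩
  refine ⟨(((√(∑ j, ‖v j‖ ^ 2))⁻¹ : ℝ) : ℂ) • v, ?_, ?_⟩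
  · simp only [Pi.smul_apply, norm_smul, Complex.norm_real, Real.norm_eq_abs, mul_pow, sq_abs,
      inv_pow, Real.sq_sqrt hpos.le, ← Finset.mul_sum]
    exact inv_mul_cancel₀ hpos.ne'
  · rw [Matrix.mulVec_smul, hMv, smul_zero]

theorem stmt_17 (s : ℕ) (hs : 1 ≤ s) (ω : ℝ) (hω : ω ∈ Set.Ioo (0:ℝ) 1)
    (a : Fin (s+1) → ℝ) (ha0 : a 0 = 0) (ha1 : 0 < a 1) (hmono : Monotone a)
    (x : Fin s → (Fin s → ℝ)) (hx : ∀ k, x k ∈ Set.Icc (0 : Fin s → ℝ) 1) :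
    ∃ α : Fin (s+1) → ℂ,
      (∑ j : Fin (s+1), ‖α j‖ ^ 2 = 1) ∧
      (∀ k : Fin s,
        α 0 + ∑ j : Fin s,
          α j.succ * Complex.exp (2 * Real.pi * Complex.I * (x k j : ℂ)) = 0) ∧
      (∫ z in Set.Icc (0 : Fin s → ℝ) 1,
        ‖α 0 + ∑ j : Fin s,
          α j.succ * Complex.exp (2 * Real.pi * Complex.I * (z j : ℂ))‖ ^ 2 = 1) ∧
      (∑ j : Fin (s+1), ∑ k : Fin (s+1),
          (if j ≠ k then ‖α j‖ ^ 2 * ‖α k‖ ^ 2 * ω ^ (-(a j + a k)) else 0) ≤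
        ω ^ (-(2 * a (Fin.last s)))) := by
  let n : Fin (s + 1) → Fin s → ℤ := Fin.cons 0 fun j => Pi.single j 1
  have hn : Function.Injective n := by
    refine Fin.cons_injective_iff.mpr ⟨?_, fun i j h => ?_⟩
    · rintro ⟨j, hj⟩
      simpa using congrFun hj j
    · by_contra hij
      simpa [hij] using congrFun h i
  have hchar : ∀ (α : Fin (s + 1) → ℂ) (z : Fin s → ℝ),
      ∑ j, α j * fourierChar (n j) z = α 0 + ∑ j : Fin s,
        α j.succ * Complex.exp (2 * Real.pi * Complex.I * (z j : ℂ)) := fun α z => by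
    simp [Fin.sum_univ_succ, n, fourierChar, Pi.single_apply]
  obtain ⟨α, hα, hker⟩ := exists_sum_norm_sq_eq_one_of_card_lt (by simp)
    (Matrix.of fun (k : Fin s) (j : Fin (s + 1)) => fourierChar (n j) (x k))
  refine ⟨α, hα, fun k => ?_, ?_, ?_⟩
  · rw [← hchar]
    simpa [Matrix.mulVec, dotProduct, mul_comm] using congrFun hker k
  · simp only [← hchar]
    rw [integral_normSq_sum_fourierChar n hn, hα]
  · calc _ ≤ ∑ j, ∑ k, ‖α j‖ ^ 2 * ‖α k‖ ^ 2 * ω ^ (-(2 * a (Fin.last s))) := by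
          gcongr with j _ k _
          split_ifs
          · have hexp : -(2 * a (Fin.last s)) ≤ -(a j + a k) := by
              linarith [hmono (Fin.le_last j), hmono (Fin.le_last k)]
            exact mul_le_mul_of_nonneg_left
              (Real.rpow_le_rpow_of_exponent_ge hω.1 hω.2.le hexp) (by positivity)
          · have := hω.1
            positivity
      _ = ω ^ (-(2 * a (Fin.last s))) := by
          simp only [← Finset.sum_mul, ← Finset.mul_sum, hα, mul_one, one_mul]
end

section
/- Let ω ∈ (0,1) and let (a_s)_{s≥1} be positive reals. Let e : ℕ × ℕ → ℝ be such that for every s ≥ 1 the function n ↦ e(n,s) is nonincreasing, nonnegative, and tends to 0 as n → ∞; for ε > 0 and s ≥ 1 let n(ε,s) := min{n ∈ ℕ : e(n,s) ≤ ε}. Assume there exist C > 0 and τ > 0 with n(ε,s) ≤ C·ε^{−τ} for all ε ∈ (0,1) and all s ≥ 1, and assume e(s,s) ≥ ω^{a_s}/√(1 + ω^{2·a_s}) for all s ≥ 1. Then liminf_{s→∞} a_s/log s ≥ 1/(τ·log(1/ω)). -/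
theorem stmt_19 (ω : ℝ) (hω : ω ∈ Set.Ioo (0:ℝ) 1)
    (a : ℕ → ℝ) (ha : ∀ s, 0 < a s)
    (e : ℕ → ℕ → ℝ)
    (hmono : ∀ s : ℕ, 1 ≤ s → ∀ m n : ℕ, m ≤ n → e n s ≤ e m s)
    (hnonneg : ∀ n s : ℕ, 0 ≤ e n s)
    (hlim : ∀ s : ℕ, 1 ≤ s →
      Filter.Tendsto (fun n => e n s) Filter.atTop (nhds 0))
    (C τ : ℝ) (hC : 0 < C) (hτ : 0 < τ)
    (hSPT : ∀ ε ∈ Set.Ioo (0:ℝ) 1, ∀ s : ℕ, 1 ≤ s →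
      ((sInf {n : ℕ | e n s ≤ ε} : ℕ) : ℝ) ≤ C * ε ^ (-τ))
    (hlower : ∀ s : ℕ, 1 ≤ s →
      ω ^ (a s) / Real.sqrt (1 + ω ^ (2 * a s)) ≤ e s s) :
    ((1 / (τ * Real.log (1/ω)) : ℝ) : EReal) ≤
      Filter.liminf (fun s : ℕ => ((a s / Real.log (s:ℝ) : ℝ) : EReal))
        Filter.atTop := by
  obtain ⟨hω0, hω1⟩ := hω
  have hL : 0 < Real.log (1 / ω) := Real.log_pos (by rw [lt_div_iff₀ hω0]; linarith)
  have hτL : 0 < τ * Real.log (1 / ω) := mul_pos hτ hL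
  set K : ℝ := Real.log C + τ * Real.log 2 with hK
  have key : ∀ s : ℕ, 1 ≤ s → Real.log s ≤ K + τ * Real.log (1 / ω) * a s := by
    intro s hs
    have hx0 : 0 < ω ^ a s := Real.rpow_pos_of_pos hω0 _
    have hx1 : ω ^ a s < 1 := Real.rpow_lt_one hω0.le hω1 (ha s)
    have hsq : ω ^ (2 * a s) < 1 := Real.rpow_lt_one hω0.le hω1 (by linarith [ha s])
    have hsq0 : 0 < ω ^ (2 * a s) := Real.rpow_pos_of_pos hω0 _
    have hε0 : 0 < ω ^ a s / 2 := by positivity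
    have hlt : ω ^ a s / 2 < e s s := by
      refine lt_of_lt_of_le ?_ (hlower s hs)
      refine div_lt_div_of_pos_left hx0 (Real.sqrt_pos.2 (by linarith)) ?_
      rw [Real.sqrt_lt' (by norm_num)]
      linarith
    have hne : {n : ℕ | e n s ≤ ω ^ a s / 2}.Nonempty :=
      ((hlim s hs).eventually_le_const hε0).exists
    have hs_le : s ≤ sInf {n : ℕ | e n s ≤ ω ^ a s / 2} := by
      by_contra! h
      have hmem : e (sInf {n : ℕ | e n s ≤ ω ^ a s / 2}) s ≤ ω ^ a s / 2 := Nat.sInf_mem hne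
      exact absurd ((hmono s hs _ _ h.le).trans hmem) (not_le.2 hlt)
    have hbound : (s : ℝ) ≤ C * (ω ^ a s / 2) ^ (-τ) :=
      (Nat.cast_le.2 hs_le).trans (hSPT _ ⟨hε0, by linarith⟩ s hs)
    have hlog := Real.log_le_log (by exact_mod_cast hs) hbound
    rw [Real.log_mul hC.ne' (Real.rpow_pos_of_pos hε0 _).ne', Real.log_rpow hε0,
      Real.log_div hx0.ne' two_ne_zero, Real.log_rpow hω0] at hlog
    rw [hK, one_div, Real.log_inv]
    linarith
  have hlogs : Filter.Tendsto (fun s : ℕ => Real.log (s : ℝ)) Filter.atTop Filter.atTop :=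
    Real.tendsto_log_atTop.comp tendsto_natCast_atTop_atTop
  have htend : Filter.Tendsto
      (fun s : ℕ => (1 - K / Real.log (s : ℝ)) / (τ * Real.log (1 / ω)))
      Filter.atTop (nhds (1 / (τ * Real.log (1 / ω)))) := by
    simpa using ((hlogs.const_div_atTop K).const_sub 1).div_const (τ * Real.log (1 / ω))
  have htendE := (continuous_coe_real_ereal.tendsto _).comp htend
  rw [← htendE.liminf_eq]
  refine Filter.liminf_le_liminf ?_
  filter_upwards [hlogs.eventually_gt_atTop 0, Filter.eventually_ge_atTop 1] with s hpos hs
  refine EReal.coe_le_coe_iff.2 ?_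
  rw [div_le_div_iff₀ hτL hpos, sub_mul, div_mul_cancel₀ _ hpos.ne']
  linarith [key s hs]
end
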